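/- Let β > n and let μ be a probability measure on ℝⁿ with density p(x) = V(x)^{−β}, where V is a positive convex function on ℝⁿ (possibly taking the value +∞), and set κ = −1/(β − n). Let r > 0 be such that μ(B_r) > 1/2, where B_r = {x : |x| ≤ r}, and set D = (1 − κ)/log(2μ(B_r)). Then for every smooth function g on ℝⁿ with μ-median zero, ∫ |g| dμ ≤ D ∫ |∇g(x)| (r + |x|) dμ(x). -/

import Mathlib

open MeasureTheory Real
open scoped ENNReal

open Set Filter Topology
open scoped NNReal Pointwise

/-- **Layer cake formula** for an extended nonnegative function that is almost everywhere finite. -/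
lemma lintegral_eq_lintegral_meas_ofReal_lt {α : Type*} [MeasurableSpace α] (μ : Measure α)
    {f : α → ℝ≥0∞} (hf : Measurable f) (hfin : ∀ᵐ x ∂μ, f x ≠ ∞) :
    ∫⁻ x, f x ∂μ = ∫⁻ u in Ioi (0 : ℝ), μ {x | ENNReal.ofReal u < f x} := by
  have h1 : ∫⁻ x, f x ∂μ = ∫⁻ x, ENNReal.ofReal (f x).toReal ∂μ :=
    lintegral_congr_ae (hfin.mono fun x hx => (ENNReal.ofReal_toReal hx).symm)
  rw [h1, lintegral_eq_lintegral_meas_lt μ (Eventually.of_forall fun x => ENNReal.toReal_nonneg)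
    hf.ennreal_toReal.aemeasurable]
  refine setLIntegral_congr_fun measurableSet_Ioi fun u hu => ?_
  refine measure_congr (hfin.mono fun x hx => ?_)
  exact propext (ENNReal.ofReal_lt_iff_lt_toReal (le_of_lt hu) hx).symm

/-- The layer cake formula as an inequality, without any finiteness assumption. -/
lemma lintegral_meas_ofReal_lt_le {α : Type*} [MeasurableSpace α] (μ : Measure α)
    {f : α → ℝ≥0∞} (hf : Measurable f) :
    ∫⁻ u in Ioi (0 : ℝ), μ {x | ENNReal.ofReal u < f x} ≤ ∫⁻ x, f x ∂μ := by
  by_cases h : ∫⁻ x, f x ∂μ = ∞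
  · rw [h]; exact le_top
  · exact (lintegral_eq_lintegral_meas_ofReal_lt μ hf
      ((ae_lt_top hf h).mono fun x hx => hx.ne)).ge

/-- The one-dimensional Brunn-Minkowski inequality for compact sets. -/
lemma volume_add_le_of_isCompact {K L C : Set ℝ} (hK : IsCompact K) (hL : IsCompact L)
    (hK0 : K.Nonempty) (hL0 : L.Nonempty) (hC : K + L ⊆ C) :
    volume K + volume L ≤ volume C := by
  set a := sSup K
  set b := sInf L
  have ha : a ∈ K := hK.sSup_mem hK0
  have hb : b ∈ L := hL.sInf_mem hL0
  have hKm : volume ((fun x => x + b) '' K) = volume K := by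
    rw [image_add_right, measure_preimage_add_right]
  have hLm : volume ((fun x => x + a) '' L) = volume L := by
    rw [image_add_right, measure_preimage_add_right]
  have hLmeas : MeasurableSet ((fun x => x + a) '' L) :=
    (hL.image (by fun_prop)).measurableSet
  have hd : AEDisjoint volume ((fun x => x + b) '' K) ((fun x => x + a) '' L) := by
    refine measure_mono_null (t := {a + b}) ?_ (by simp)
    rintro _ ⟨⟨x, hx, rfl⟩, ⟨y, hy, hxy⟩⟩
    have h1 : x ≤ a := le_csSup hK.bddAbove hx
    have h2 : b ≤ y := csInf_le hL.bddBelow hy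
    simp only [mem_singleton_iff] at hxy ⊢
    linarith
  rw [← hKm, ← hLm, ← measure_union₀ hLmeas.nullMeasurableSet hd]
  refine measure_mono (union_subset ?_ ?_)
  · rintro _ ⟨x, hx, rfl⟩
    exact hC (add_mem_add hx hb)
  · rintro _ ⟨x, hx, rfl⟩
    simpa only [add_comm] using hC (add_mem_add ha hx)

lemma measure_eq_iSup_nonempty_isCompact {A : Set ℝ} (hA : MeasurableSet A) :
    volume A = ⨆ K : {K : Set ℝ // IsCompact K ∧ K.Nonempty ∧ K ⊆ A}, volume K.1 := by
  refine le_antisymm ?_ (iSup_le fun K => measure_mono K.2.2.2)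
  refine le_of_forall_lt fun r hr => ?_
  obtain ⟨K, hKA, hK, hrK⟩ := hA.exists_lt_isCompact hr
  have hne : K.Nonempty := by
    rw [nonempty_iff_ne_empty]
    rintro rfl
    simp at hrK
  exact hrK.trans_le (le_iSup (fun K : {K : Set ℝ // IsCompact K ∧ K.Nonempty ∧ K ⊆ A} =>
    volume K.1) ⟨K, hK, hne, hKA⟩)

/-- The one-dimensional **Brunn-Minkowski inequality**. -/
lemma volume_add_le {A B C : Set ℝ} (hA : MeasurableSet A) (hB : MeasurableSet B)
    (hA0 : A.Nonempty) (hB0 : B.Nonempty) (hC : A + B ⊆ C) :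
    volume A + volume B ≤ volume C := by
  have : Nonempty {K : Set ℝ // IsCompact K ∧ K.Nonempty ∧ K ⊆ A} :=
    let ⟨x, hx⟩ := hA0
    ⟨⟨{x}, isCompact_singleton, singleton_nonempty x, by simpa using hx⟩⟩
  have : Nonempty {K : Set ℝ // IsCompact K ∧ K.Nonempty ∧ K ⊆ B} :=
    let ⟨x, hx⟩ := hB0
    ⟨⟨{x}, isCompact_singleton, singleton_nonempty x, by simpa using hx⟩⟩
  rw [measure_eq_iSup_nonempty_isCompact hA, measure_eq_iSup_nonempty_isCompact hB]
  exact ENNReal.iSup_add_iSup_le fun K L => volume_add_le_of_isCompact K.2.1 L.2.1 K.2.2.1 L.2.2.1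
    ((add_subset_add K.2.2.2 L.2.2.2).trans hC)

lemma volume_weighted_add_le {A B C : Set ℝ} (hA : MeasurableSet A) (hB : MeasurableSet B)
    (hA0 : A.Nonempty) (hB0 : B.Nonempty) {s t : ℝ≥0}
    (hC : ∀ x ∈ A, ∀ y ∈ B, s * x + t * y ∈ C) :
    s * volume A + t * volume B ≤ volume C := by
  have hsm : ∀ (c : ℝ≥0) (D : Set ℝ), volume ((c : ℝ) • D) = c * volume D := fun c D => by
    rw [Measure.addHaar_smul]
    simp
  rw [← hsm, ← hsm]
  refine volume_add_le (hA.const_smul₀ _) (hB.const_smul₀ _) hA0.smul_set hB0.smul_set ?_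
  rintro _ ⟨_, ⟨x, hx, rfl⟩, _, ⟨y, hy, rfl⟩, rfl⟩
  exact hC x hx y hy

/-- The one-dimensional Prékopa-Leindler-type inequality for functions of equal supremum. -/
lemma lintegral_weighted_add_le_of_min_le {f g h : ℝ → ℝ≥0∞} (hf : Measurable f)
    (hg : Measurable g) (hh : Measurable h) (hf1 : ⨆ x, f x = 1) (hg1 : ⨆ x, g x = 1)
    {s t : ℝ≥0} (H : ∀ x y, min (f x) (g y) ≤ h (s * x + t * y)) :
    s * (∫⁻ x, f x) + t * (∫⁻ x, g x) ≤ ∫⁻ x, h x := by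
  have hfle : ∀ x, f x ≤ 1 := fun x => hf1 ▸ le_iSup f x
  have hgle : ∀ x, g x ≤ 1 := fun x => hg1 ▸ le_iSup g x
  have hne : ∀ {a : ℝ≥0∞}, a ≤ 1 → a ≠ ∞ := fun h => (h.trans_lt ENNReal.one_lt_top).ne
  refine le_trans ?_ (lintegral_meas_ofReal_lt_le volume hh)
  rw [lintegral_eq_lintegral_meas_ofReal_lt volume hf (.of_forall fun x => hne (hfle x)),
    lintegral_eq_lintegral_meas_ofReal_lt volume hg (.of_forall fun x => hne (hgle x))]
  have hmeas : ∀ {F : ℝ → ℝ≥0∞}, Measurable fun u : ℝ => volume {x | ENNReal.ofReal u < F x} :=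
    fun {F} => Antitone.measurable fun u v huv =>
      measure_mono fun x hx => (ENNReal.ofReal_le_ofReal huv).trans_lt hx
  rw [← lintegral_const_mul _ hmeas, ← lintegral_const_mul _ hmeas,
    ← lintegral_add_left (hmeas.const_mul _)]
  refine lintegral_mono fun u => ?_
  by_cases hu : ENNReal.ofReal u < 1
  · obtain ⟨x, hx⟩ := lt_iSup_iff.1 (hf1 ▸ hu)
    obtain ⟨y, hy⟩ := lt_iSup_iff.1 (hg1 ▸ hu)
    exact volume_weighted_add_le (measurableSet_lt measurable_const hf)
      (measurableSet_lt measurable_const hg) ⟨x, hx⟩ ⟨y, hy⟩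
      fun x hx y hy => (lt_min hx hy).trans_le (H x y)
  · have h0 : ∀ {F : ℝ → ℝ≥0∞}, (∀ x, F x ≤ 1) → {x | ENNReal.ofReal u < F x} = ∅ :=
      fun hF => eq_empty_of_forall_notMem fun x hx => hu (lt_of_lt_of_le hx (hF x))
    simp [h0 hfle, h0 hgle]

/-- The weighted power mean `(s a^(-1/β) + t b^(-1/β))^(-β)` of order `-1/β`. -/
noncomputable def negPowMean (s t : ℝ≥0) (β : ℝ) (a b : ℝ≥0∞) : ℝ≥0∞ :=
  (s * a ^ (-β⁻¹) + t * b ^ (-β⁻¹)) ^ (-β)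

section negPowMean

variable {s t : ℝ≥0} {β : ℝ} {a b : ℝ≥0∞}

lemma negPowMean_comm : negPowMean s t β a b = negPowMean t s β b a := by
  rw [negPowMean, negPowMean, add_comm]

lemma negPowMean_zero_left (hs : s ≠ 0) (hβ : 0 < β) : negPowMean s t β 0 b = 0 := by
  rw [negPowMean, ENNReal.zero_rpow_of_neg (by simpa using hβ),
    ENNReal.mul_top (by simpa using hs), top_add, ENNReal.top_rpow_of_neg (by simpa using hβ)]

lemma negPowMean_zero_right (ht : t ≠ 0) (hβ : 0 < β) : negPowMean s t β a 0 = 0 := by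
  rw [negPowMean_comm, negPowMean_zero_left ht hβ]

lemma ENNReal.rpow_neg_le_rpow_neg {x y : ℝ≥0∞} {p : ℝ} (hp : 0 ≤ p) (h : x ≤ y) :
    y ^ (-p) ≤ x ^ (-p) := by
  rw [ENNReal.rpow_neg, ENNReal.rpow_neg]
  exact ENNReal.inv_le_inv.2 (ENNReal.rpow_le_rpow h hp)

lemma negPowMean_mono (hβ : 0 ≤ β) {a' b' : ℝ≥0∞} (ha : a ≤ a') (hb : b ≤ b') :
    negPowMean s t β a b ≤ negPowMean s t β a' b' := by
  refine ENNReal.rpow_neg_le_rpow_neg hβ ?_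
  gcongr 1
  · gcongr 1
    exact ENNReal.rpow_neg_le_rpow_neg (inv_nonneg.2 hβ) ha
  · gcongr 1
    exact ENNReal.rpow_neg_le_rpow_neg (inv_nonneg.2 hβ) hb

lemma tendsto_negPowMean {ι : Type*} {l : Filter ι} {f g : ι → ℝ≥0∞}
    (hf : Tendsto f l (𝓝 a)) (hg : Tendsto g l (𝓝 b)) :
    Tendsto (fun i => negPowMean s t β (f i) (g i)) l (𝓝 (negPowMean s t β a b)) := by
  have h : ∀ {p : ℝ} {F : ι → ℝ≥0∞} {c : ℝ≥0∞}, Tendsto F l (𝓝 c) →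
      Tendsto (fun i => F i ^ p) l (𝓝 (c ^ p)) :=
    fun hF => (ENNReal.continuous_rpow_const.tendsto _).comp hF
  exact h ((ENNReal.Tendsto.const_mul (h hf) (.inr ENNReal.coe_ne_top)).add
    (ENNReal.Tendsto.const_mul (h hg) (.inr ENNReal.coe_ne_top)))

lemma negPowMean_inner_ne (hs : s ≠ 0) (ha : a ≠ 0) (ha' : a ≠ ∞) (hb : b ≠ 0) (hb' : b ≠ ∞) :
    (s : ℝ≥0∞) * a ^ (-β⁻¹) + t * b ^ (-β⁻¹) ≠ 0 ∧
      (s : ℝ≥0∞) * a ^ (-β⁻¹) + t * b ^ (-β⁻¹) ≠ ∞ := by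
  constructor
  · have := (ENNReal.rpow_pos (p := -β⁻¹) (pos_iff_ne_zero.2 ha) ha').ne'
    simp [hs, this]
  · exact ENNReal.add_ne_top.2
      ⟨ENNReal.mul_ne_top ENNReal.coe_ne_top (ENNReal.rpow_ne_top_of_ne_zero ha ha'),
        ENNReal.mul_ne_top ENNReal.coe_ne_top (ENNReal.rpow_ne_top_of_ne_zero hb hb')⟩

lemma negPowMean_ne (hs : s ≠ 0) (ha : a ≠ 0) (ha' : a ≠ ∞) (hb : b ≠ 0) (hb' : b ≠ ∞) :
    negPowMean s t β a b ≠ 0 ∧ negPowMean s t β a b ≠ ∞ := by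
  obtain ⟨h1, h2⟩ := negPowMean_inner_ne (β := β) (t := t) hs ha ha' hb hb'
  exact ⟨(ENNReal.rpow_pos (pos_iff_ne_zero.2 h1) h2).ne', ENNReal.rpow_ne_top_of_ne_zero h1 h2⟩

lemma negPowMean_const_mul (hs : s ≠ 0) (hβ : 0 < β) (ha : a ≠ 0) (ha' : a ≠ ∞) (hb : b ≠ 0)
    (hb' : b ≠ ∞) {c : ℝ≥0∞} (hc : c ≠ 0) (hc' : c ≠ ∞) :
    negPowMean s t β (c * a) (c * b) = c * negPowMean s t β a b := by
  obtain ⟨h1, h2⟩ := negPowMean_inner_ne (β := β) (t := t) hs ha ha' hb hb'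
  have h3 : c ^ (-β⁻¹) ≠ 0 := (ENNReal.rpow_pos (pos_iff_ne_zero.2 hc) hc').ne'
  rw [negPowMean, ENNReal.mul_rpow_of_ne_zero hc ha, ENNReal.mul_rpow_of_ne_zero hc hb,
    mul_left_comm, mul_left_comm (t : ℝ≥0∞), ← mul_add, ENNReal.mul_rpow_of_ne_zero h3 h1,
    ← ENNReal.rpow_mul, negPowMean]
  congr 1
  rw [neg_mul_neg, inv_mul_cancel₀ hβ.ne', ENNReal.rpow_one]

end negPowMean

/-- **Radon's inequality** for two terms: joint convexity of `(A, X) ↦ A ^ p * X ^ (-(p - 1))`. -/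
lemma Real.radon_inequality {s t A B X Y p : ℝ} (hs : 0 < s) (ht : 0 < t) (hA : 0 < A)
    (hB : 0 < B) (hX : 0 < X) (hY : 0 < Y) (hp : 1 ≤ p) :
    (s * A + t * B) ^ p * (s * X + t * Y) ^ (-(p - 1)) ≤
      s * (A ^ p * X ^ (-(p - 1))) + t * (B ^ p * Y ^ (-(p - 1))) := by
  set S := s * X + t * Y with hS
  have hS0 : 0 < S := by positivity
  have key := (convexOn_rpow hp).2 (show A / X ∈ Ici (0 : ℝ) from by simp; positivity)
    (show B / Y ∈ Ici (0 : ℝ) from by simp; positivity)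
    (show 0 ≤ s * X / S by positivity) (show 0 ≤ t * Y / S by positivity)
    (by rw [← add_div, div_self hS0.ne'])
  simp only [smul_eq_mul] at key
  have e1 : s * X / S * (A / X) + t * Y / S * (B / Y) = (s * A + t * B) / S := by
    field_simp
  have hpow : ∀ Z : ℝ, 0 < Z → Z ^ (-(p - 1)) = Z / Z ^ p := fun Z hZ => by
    rw [neg_sub, Real.rpow_sub hZ, Real.rpow_one]
  rw [e1, Real.div_rpow (by positivity) hS0.le, Real.div_rpow hA.le hX.le,
    Real.div_rpow hB.le hY.le] at key
  rw [hpow S hS0, hpow X hX, hpow Y hY]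
  calc (s * A + t * B) ^ p * (S / S ^ p) = S * ((s * A + t * B) ^ p / S ^ p) := by ring
    _ ≤ S * (s * X / S * (A ^ p / X ^ p) + t * Y / S * (B ^ p / Y ^ p)) := by gcongr
    _ = _ := by field_simp

/-- **Hölder's inequality for power means** of orders `-1/β` and `1`. -/
lemma Real.holder_negPowMean {s t a b u v β : ℝ} (hs : 0 < s) (ht : 0 < t) (ha : 0 < a)
    (hb : 0 < b) (hu : 0 < u) (hv : 0 < v) (hβ : 1 < β) :
    (s * (a * u) ^ (-(β - 1)⁻¹) + t * (b * v) ^ (-(β - 1)⁻¹)) ^ (-(β - 1)) ≤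
      (s * a ^ (-β⁻¹) + t * b ^ (-β⁻¹)) ^ (-β) * (s * u + t * v) := by
  have hβ1 : β - 1 ≠ 0 := (sub_pos.2 hβ).ne'
  have hβ0 : β ≠ 0 := by linarith
  have key := Real.radon_inequality (A := a ^ (-β⁻¹)) (B := b ^ (-β⁻¹))
    (X := (a * u) ^ (-(β - 1)⁻¹)) (Y := (b * v) ^ (-(β - 1)⁻¹)) (p := β) hs ht
    (by positivity) (by positivity) (by positivity) (by positivity) hβ.le
  have e : ∀ {c w : ℝ}, 0 < c → 0 < w →
      (c ^ (-β⁻¹)) ^ β * ((c * w) ^ (-(β - 1)⁻¹)) ^ (-(β - 1)) = w := fun {c w} hc hw => by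
    rw [← Real.rpow_mul hc.le, ← Real.rpow_mul (by positivity), neg_mul_neg,
      inv_mul_cancel₀ hβ1, neg_mul, inv_mul_cancel₀ hβ0, Real.rpow_one, Real.rpow_neg_one]
    field_simp
  rw [e ha hu, e hb hv] at key
  set T := s * a ^ (-β⁻¹) + t * b ^ (-β⁻¹)
  have hT : 0 < T := by positivity
  rw [Real.rpow_neg hT.le, ← div_eq_inv_mul, le_div_iff₀ (by positivity), mul_comm]
  exact key

lemma negPowMean_mul_le {s t : ℝ≥0} {β : ℝ} {a b u v : ℝ≥0∞} (hs : s ≠ 0) (ht : t ≠ 0)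
    (hβ : 1 < β) (ha : a ≠ 0) (ha' : a ≠ ∞) (hb : b ≠ 0) (hb' : b ≠ ∞) :
    negPowMean s t (β - 1) (a * u) (b * v) ≤ negPowMean s t β a b * (s * u + t * v) := by
  have hβ1 : 0 < β - 1 := sub_pos.2 hβ
  rcases eq_or_ne u 0 with rfl | hu
  · rw [mul_zero, negPowMean_zero_left hs hβ1]; exact zero_le
  rcases eq_or_ne v 0 with rfl | hv
  · rw [mul_zero, negPowMean_zero_right ht hβ1]; exact zero_le
  rcases eq_or_ne u ∞ with rfl | hu'
  · rw [ENNReal.mul_top (ENNReal.coe_ne_zero.2 hs), top_add,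
      ENNReal.mul_top (negPowMean_ne hs ha ha' hb hb').1]
    exact le_top
  rcases eq_or_ne v ∞ with rfl | hv'
  · rw [ENNReal.mul_top (ENNReal.coe_ne_zero.2 ht), add_top,
      ENNReal.mul_top (negPowMean_ne hs ha ha' hb hb').1]
    exact le_top
  lift a to ℝ≥0 using ha'
  lift b to ℝ≥0 using hb'
  lift u to ℝ≥0 using hu'
  lift v to ℝ≥0 using hv'
  norm_cast at ha hb hu hv
  have hpos : ∀ {c : ℝ≥0} {p : ℝ}, c ≠ 0 → c ^ p ≠ 0 := fun hc =>
    (NNReal.rpow_pos (pos_iff_ne_zero.2 hc)).ne'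
  have hne : ∀ {c d : ℝ≥0} {p : ℝ}, c ≠ 0 → s * c ^ p + t * d ^ p ≠ 0 := fun hc => by
    simp [hs, hpos hc]
  rw [negPowMean, negPowMean, ← ENNReal.coe_mul, ← ENNReal.coe_mul,
    ← ENNReal.coe_rpow_of_ne_zero (mul_ne_zero ha hu),
    ← ENNReal.coe_rpow_of_ne_zero (mul_ne_zero hb hv), ← ENNReal.coe_rpow_of_ne_zero ha,
    ← ENNReal.coe_rpow_of_ne_zero hb]
  norm_cast
  rw [← ENNReal.coe_rpow_of_ne_zero (hne (mul_ne_zero ha hu)),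
    ← ENNReal.coe_rpow_of_ne_zero (hne ha)]
  norm_cast
  rw [← NNReal.coe_le_coe]
  push_cast
  exact Real.holder_negPowMean (by positivity) (by positivity) (by positivity) (by positivity)
    (by positivity) (by positivity) hβ

/-- The one-dimensional **Borell-Brascamp-Lieb inequality** for bounded functions. -/
lemma negPowMean_lintegral_le_of_bounded {f g h : ℝ → ℝ≥0∞} (hf : Measurable f)
    (hg : Measurable g) (hh : Measurable h) (hf1 : ⨆ x, f x ≠ ∞) (hg1 : ⨆ x, g x ≠ ∞)
    {s t : ℝ≥0} (hs : s ≠ 0) (ht : t ≠ 0) {β : ℝ} (hβ : 1 < β)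
    (H : ∀ x y, negPowMean s t β (f x) (g y) ≤ h (s * x + t * y)) :
    negPowMean s t (β - 1) (∫⁻ x, f x) (∫⁻ x, g x) ≤ ∫⁻ x, h x := by
  have hβ0 : 0 < β := by linarith
  set a := ⨆ x, f x with ha
  set b := ⨆ x, g x with hb
  rcases eq_or_ne a 0 with ha0 | ha0
  · have : ∀ x, f x = 0 := by simpa [ha0] using ha.symm
    simp [this, negPowMean_zero_left hs (sub_pos.2 hβ)]
  rcases eq_or_ne b 0 with hb0 | hb0
  · have : ∀ x, g x = 0 := by simpa [hb0] using hb.symm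
    simp [this, negPowMean_zero_right ht (sub_pos.2 hβ)]
  obtain ⟨hm0, hm1⟩ := negPowMean_ne (β := β) (t := t) hs ha0 hf1 hb0 hg1
  set m := negPowMean s t β a b with hm
  have key := lintegral_weighted_add_le_of_min_le (f := fun x => a⁻¹ * f x)
    (g := fun x => b⁻¹ * g x) (h := fun x => m⁻¹ * h x) (s := s) (t := t)
    (hf.const_mul _) (hg.const_mul _) (hh.const_mul _)
    (by rw [← ENNReal.mul_iSup, ← ha, ENNReal.inv_mul_cancel ha0 hf1])
    (by rw [← ENNReal.mul_iSup, ← hb, ENNReal.inv_mul_cancel hb0 hg1]) ?_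
  · rw [lintegral_const_mul _ hf, lintegral_const_mul _ hg, lintegral_const_mul _ hh] at key
    have hol := negPowMean_mul_le (u := a⁻¹ * ∫⁻ x, f x) (v := b⁻¹ * ∫⁻ x, g x)
      hs ht hβ ha0 hf1 hb0 hg1
    rw [ENNReal.mul_inv_cancel_left ha0 hf1, ENNReal.mul_inv_cancel_left hb0 hg1] at hol
    refine hol.trans ?_
    calc m * _ ≤ m * (m⁻¹ * ∫⁻ x, h x) := by gcongr
      _ = _ := ENNReal.mul_inv_cancel_left hm0 hm1
  · intro x y
    set c := min (a⁻¹ * f x) (b⁻¹ * g y) with hc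
    have hca : a * c ≤ f x := by
      calc a * c ≤ a * (a⁻¹ * f x) := by gcongr; exact min_le_left _ _
        _ = _ := ENNReal.mul_inv_cancel_left ha0 hf1
    have hcb : b * c ≤ g y := by
      calc b * c ≤ b * (b⁻¹ * g y) := by gcongr; exact min_le_right _ _
        _ = _ := ENNReal.mul_inv_cancel_left hb0 hg1
    rcases eq_or_ne c 0 with hc0 | hc0
    · rw [hc0]; exact zero_le
    have hc1 : c ≠ ∞ := by
      rintro h
      rw [h, ENNReal.mul_top ha0, top_le_iff] at hca
      exact hf1 (top_le_iff.1 (hca ▸ le_iSup f x))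
    have h1 : m * c ≤ h (s * x + t * y) := by
      rw [mul_comm, hm, ← negPowMean_const_mul hs hβ0 ha0 hf1 hb0 hg1 hc0 hc1,
        mul_comm c a, mul_comm c b]
      exact (negPowMean_mono hβ0.le hca hcb).trans (H x y)
    calc c = m⁻¹ * (m * c) := (ENNReal.inv_mul_cancel_left hm0 hm1).symm
      _ ≤ _ := by gcongr

lemma tendsto_lintegral_min_natCast {α : Type*} [MeasurableSpace α] {μ : Measure α}
    {f : α → ℝ≥0∞} (hf : Measurable f) :
    Tendsto (fun N : ℕ => ∫⁻ x, min (f x) N ∂μ) atTop (𝓝 (∫⁻ x, f x ∂μ)) := by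
  refine lintegral_tendsto_of_tendsto_of_monotone (fun N => (hf.min measurable_const).aemeasurable)
    (.of_forall fun x N M hNM => by dsimp only; gcongr) (.of_forall fun x => ?_)
  simpa using tendsto_const_nhds.min ENNReal.tendsto_nat_nhds_top

/-- The one-dimensional **Borell-Brascamp-Lieb inequality**. -/
lemma negPowMean_lintegral_le {f g h : ℝ → ℝ≥0∞} (hf : Measurable f)
    (hg : Measurable g) (hh : Measurable h)
    {s t : ℝ≥0} (hs : s ≠ 0) (ht : t ≠ 0) {β : ℝ} (hβ : 1 < β)
    (H : ∀ x y, negPowMean s t β (f x) (g y) ≤ h (s * x + t * y)) :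
    negPowMean s t (β - 1) (∫⁻ x, f x) (∫⁻ x, g x) ≤ ∫⁻ x, h x := by
  have hb : ∀ (F : ℝ → ℝ≥0∞) (N : ℕ), ⨆ x, min (F x) N ≠ ∞ := fun F N =>
    ((iSup_le fun x => min_le_right _ _).trans_lt (ENNReal.natCast_lt_top N)).ne
  refine le_of_tendsto' (tendsto_negPowMean (tendsto_lintegral_min_natCast hf)
    (tendsto_lintegral_min_natCast hg)) fun N => ?_
  exact negPowMean_lintegral_le_of_bounded (hf.min measurable_const) (hg.min measurable_const) hh
    (hb f N) (hb g N) hs ht hβ fun x y =>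
      (negPowMean_mono (by linarith) (min_le_left _ _) (min_le_left _ _)).trans (H x y)

lemma lintegral_pi_fin_succ {n : ℕ} {f : (Fin (n + 1) → ℝ) → ℝ≥0∞} (hf : Measurable f) :
    ∫⁻ x, f x = ∫⁻ a : ℝ, ∫⁻ x : Fin n → ℝ, f (Fin.cons a x) := by
  have hmp := (volume_preserving_piFinSuccAbove (fun _ : Fin (n + 1) => ℝ) 0).symm
  have hf' := hf.comp (MeasurableEquiv.piFinSuccAbove (fun _ : Fin (n + 1) => ℝ) 0).symm.measurable
  rw [← hmp.lintegral_comp hf, Measure.volume_eq_prod]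
  refine (lintegral_prod _ hf'.aemeasurable).trans ?_
  simp [MeasurableEquiv.piFinSuccAbove_symm_apply, Fin.insertNthEquiv]

/-- The **Borell-Brascamp-Lieb inequality** on `Fin n → ℝ`. -/
lemma negPowMean_lintegral_pi_le {s t : ℝ≥0} (hs : s ≠ 0) (ht : t ≠ 0) {n : ℕ} {β : ℝ}
    (hβ : n < β) {f g h : (Fin n → ℝ) → ℝ≥0∞} (hf : Measurable f)
    (hg : Measurable g) (hh : Measurable h)
    (H : ∀ x y, negPowMean s t β (f x) (g y) ≤ h ((s : ℝ) • x + (t : ℝ) • y)) :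
    negPowMean s t (β - n) (∫⁻ x, f x) (∫⁻ x, g x) ≤ ∫⁻ x, h x := by
  induction n with
  | zero =>
    have e : ∀ F : (Fin 0 → ℝ) → ℝ≥0∞, ∫⁻ x, F x = F 0 := fun F => by
      rw [volume_pi, Measure.pi_of_empty _ 0, lintegral_dirac]
    rw [e, e, e]
    simpa using H 0 0
  | succ n ih =>
    push_cast at hβ
    have hc : Measurable fun p : ℝ × (Fin n → ℝ) => (Fin.cons p.1 p.2 : Fin (n + 1) → ℝ) := by
      refine measurable_pi_lambda _ fun i => ?_
      refine Fin.cases ?_ (fun j => ?_) i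
      · simpa using measurable_fst
      · simpa using! (measurable_pi_apply j).comp measurable_snd
    have hm : ∀ {F : (Fin (n + 1) → ℝ) → ℝ≥0∞}, Measurable F →
        Measurable fun a : ℝ => ∫⁻ x : Fin n → ℝ, F (Fin.cons a x) :=
      fun hF => (hF.comp hc).lintegral_prod_right'
    rw [lintegral_pi_fin_succ hf, lintegral_pi_fin_succ hg, lintegral_pi_fin_succ hh,
      Nat.cast_succ, ← sub_sub]
    refine negPowMean_lintegral_le (hm hf) (hm hg) (hm hh) hs ht (by linarith) fun a b => ?_
    refine ih (by linarith) (hf.comp (hc.comp measurable_prodMk_left))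
      (hg.comp (hc.comp measurable_prodMk_left)) (hh.comp (hc.comp measurable_prodMk_left))
      fun x y => (H _ _).trans (le_of_eq ?_)
    congr 1
    ext i
    refine Fin.cases ?_ (fun j => ?_) i <;> simp

/-- The **Borell-Brascamp-Lieb inequality** on Euclidean space. -/
lemma negPowMean_lintegral_euclideanSpace_le {s t : ℝ≥0} (hs : s ≠ 0) (ht : t ≠ 0) {n : ℕ} {β : ℝ}
    (hβ : n < β) {f g h : EuclideanSpace ℝ (Fin n) → ℝ≥0∞} (hf : Measurable f)
    (hg : Measurable g) (hh : Measurable h)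
    (H : ∀ x y, negPowMean s t β (f x) (g y) ≤ h ((s : ℝ) • x + (t : ℝ) • y)) :
    negPowMean s t (β - n) (∫⁻ x, f x) (∫⁻ x, g x) ≤ ∫⁻ x, h x := by
  have hmp := PiLp.volume_preserving_toLp (Fin n)
  rw [← hmp.lintegral_comp hf, ← hmp.lintegral_comp hg, ← hmp.lintegral_comp hh]
  exact negPowMean_lintegral_pi_le hs ht hβ (hf.comp hmp.measurable) (hg.comp hmp.measurable)
    (hh.comp hmp.measurable) fun x y => by simpa using H (WithLp.toLp 2 x) (WithLp.toLp 2 y)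

/-- A measure with density `V ^ (-β)`, `V` positive and convex, is a convex measure of order
`-1/(β - n)`. -/
lemma negPowMean_measure_le {n : ℕ} {β : ℝ} (hβ : (n : ℝ) < β)
    {Ω : Set (EuclideanSpace ℝ (Fin n))} (hΩm : MeasurableSet Ω)
    {V : EuclideanSpace ℝ (Fin n) → ℝ}
    (hVpos : ∀ x ∈ Ω, 0 < V x) (hVconv : ConvexOn ℝ Ω V) (hVmeas : Measurable V)
    {s t : ℝ≥0} (hs : s ≠ 0) (ht : t ≠ 0) (hst : s + t = 1)
    {A B C : Set (EuclideanSpace ℝ (Fin n))} (hA : MeasurableSet A) (hB : MeasurableSet B)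
    (hC : MeasurableSet C) (hABC : ∀ x ∈ A, ∀ y ∈ B, (s : ℝ) • x + (t : ℝ) • y ∈ C)
    {μ : Measure (EuclideanSpace ℝ (Fin n))}
    (hμ : μ = (volume.restrict Ω).withDensity fun x => ENNReal.ofReal (V x ^ (-β))) :
    negPowMean s t (β - n) (μ A) (μ B) ≤ μ C := by
  have hβ0 : 0 < β := n.cast_nonneg.trans_lt hβ
  have hst' : (s : ℝ) + t = 1 := by exact_mod_cast hst
  set p : EuclideanSpace ℝ (Fin n) → ℝ≥0∞ := fun x => ENNReal.ofReal (V x ^ (-β)) with hp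
  have hpm : Measurable p := (hVmeas.pow_const _).ennreal_ofReal
  have hμ' : ∀ {S}, MeasurableSet S → μ S = ∫⁻ x, (S ∩ Ω).indicator p x := fun {S} hS => by
    rw [hμ, withDensity_apply _ hS, Measure.restrict_restrict hS,
      lintegral_indicator (hS.inter hΩm)]
  rw [hμ' hA, hμ' hB, hμ' hC]
  refine negPowMean_lintegral_euclideanSpace_le hs ht hβ (hpm.indicator (hA.inter hΩm))
    (hpm.indicator (hB.inter hΩm)) (hpm.indicator (hC.inter hΩm)) fun x y => ?_
  by_cases hx : x ∈ A ∩ Ω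
  swap
  · rw [indicator_of_notMem hx, negPowMean_zero_left hs hβ0]; exact zero_le
  by_cases hy : y ∈ B ∩ Ω
  swap
  · rw [indicator_of_notMem hy, negPowMean_zero_right ht hβ0]; exact zero_le
  have hz : (s : ℝ) • x + (t : ℝ) • y ∈ C ∩ Ω :=
    ⟨hABC x hx.1 y hy.1, hVconv.1 hx.2 hy.2 s.coe_nonneg t.coe_nonneg hst'⟩
  rw [indicator_of_mem hx, indicator_of_mem hy, indicator_of_mem hz]
  have hpow : ∀ {w}, w ∈ Ω → p w ^ (-β⁻¹) = ENNReal.ofReal (V w) := fun {w} hw => by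
    rw [hp, ENNReal.ofReal_rpow_of_pos (Real.rpow_pos_of_pos (hVpos w hw) _),
      ← Real.rpow_mul (hVpos w hw).le, neg_mul_neg, mul_inv_cancel₀ hβ0.ne', Real.rpow_one]
  have hpz : p ((s : ℝ) • x + (t : ℝ) • y) =
      ENNReal.ofReal (V ((s : ℝ) • x + (t : ℝ) • y)) ^ (-β) :=
    (ENNReal.ofReal_rpow_of_pos (hVpos _ hz.2)).symm
  refine le_of_le_of_eq ?_ hpz.symm
  rw [negPowMean, hpow hx.2, hpow hy.2]
  refine ENNReal.rpow_neg_le_rpow_neg hβ0.le ?_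
  rw [← ENNReal.ofReal_coe_nnreal (p := s), ← ENNReal.ofReal_coe_nnreal (p := t),
    ← ENNReal.ofReal_mul s.coe_nonneg, ← ENNReal.ofReal_mul t.coe_nonneg,
    ← ENNReal.ofReal_add (mul_nonneg s.coe_nonneg (hVpos _ hx.2).le)
      (mul_nonneg t.coe_nonneg (hVpos _ hy.2).le)]
  exact ENNReal.ofReal_le_ofReal (hVconv.2 hx.2 hy.2 s.coe_nonneg t.coe_nonneg hst')

lemma Real.le_negPowMean_of_le_half {s t a b κ : ℝ} (ht : 0 < t) (hs : 0 < s) (hst : s + t = 1)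
    (ha : 0 < a) (ha' : a ≤ 1 / 2) (hb : 1 / 2 < b) (hb' : b ≤ 1) (hκ : 0 < κ) :
    a * (1 + t * (Real.log (2 * b) / (1 + 1 / κ))) ≤
      (s * a ^ (-κ⁻¹) + t * b ^ (-κ⁻¹)) ^ (-κ) := by
  set k := κ⁻¹ with hk
  have hk0 : 0 < k := inv_pos.2 hκ
  set L := Real.log (2 * b) with hL
  have hL0 : 0 ≤ L := Real.log_nonneg (by linarith)
  have hL1 : L ≤ 1 := by
    have := Real.log_le_sub_one_of_pos (show 0 < 2 * b by linarith)
    linarith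
  rw [one_div, ← hk]
  set c := L / (1 + k) with hc
  have hpow : b ^ (-k) ≤ a ^ (-k) * (1 - k * c) := by
    have h1 : b ^ (-k) = a ^ (-k) * (b / a) ^ (-k) := by
      rw [← Real.mul_rpow ha.le (by positivity), mul_div_cancel₀ _ ha.ne']
    have h2 : (b / a) ^ (-k) ≤ (2 * b) ^ (-k) := by
      refine Real.rpow_le_rpow_of_nonpos (by linarith) ?_ (by linarith)
      rw [le_div_iff₀ ha]
      nlinarith
    have h3 : (2 * b) ^ (-k) = (Real.exp (k * L))⁻¹ := by
      rw [Real.rpow_def_of_pos (by linarith), ← Real.exp_neg, ← hL]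
      ring_nf
    have h4 : (Real.exp (k * L))⁻¹ ≤ (1 + k * L)⁻¹ := by
      refine inv_anti₀ (by positivity) ?_
      linarith [Real.add_one_le_exp (k * L)]
    have h5 : (1 + k * L)⁻¹ ≤ 1 - k * c := by
      rw [inv_eq_one_div, div_le_iff₀ (by positivity), hc]
      have : (1 - k * (L / (1 + k))) * (1 + k * L) - 1 = k ^ 2 * L * (1 - L) / (1 + k) := by
        field_simp
        ring
      have h6 : 0 ≤ k ^ 2 * L * (1 - L) / (1 + k) := by
        have : 0 ≤ 1 - L := by linarith
        positivity
      linarith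
    rw [h1]
    gcongr
    linarith
  have hak : 0 < a ^ (-k) := by positivity
  have hinner : s * a ^ (-k) + t * b ^ (-k) ≤ a ^ (-k) * Real.exp (-(k * (t * c))) := by
    have h1 := Real.add_one_le_exp (-(k * (t * c)))
    calc s * a ^ (-k) + t * b ^ (-k) ≤ s * a ^ (-k) + t * (a ^ (-k) * (1 - k * c)) := by gcongr
      _ = a ^ (-k) * ((s + t) - k * (t * c)) := by ring
      _ ≤ _ := by rw [hst]; gcongr; linarith
  calc a * (1 + t * c) ≤ a * Real.exp (t * c) := by
        gcongr; linarith [Real.add_one_le_exp (t * c)]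
    _ = (a ^ (-k) * Real.exp (-(k * (t * c)))) ^ (-κ) := by
        rw [Real.mul_rpow hak.le (Real.exp_pos _).le, ← Real.rpow_mul ha.le, ← Real.exp_mul,
          neg_mul_neg, hk, inv_mul_cancel₀ hκ.ne', Real.rpow_one]
        congr 2
        field_simp
    _ ≤ _ := Real.rpow_le_rpow_of_nonpos (by positivity) hinner (by linarith)

lemma le_negPowMean_of_le_half {s t : ℝ≥0} (hs : s ≠ 0) (ht : t ≠ 0) (hst : s + t = 1)
    {a b : ℝ≥0∞} {κ : ℝ} (ha : a ≤ 1 / 2) (hb : 1 / 2 < b) (hb' : b ≤ 1) (hκ : 0 < κ) :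
    a * (1 + ENNReal.ofReal (t * (Real.log (2 * b.toReal) / (1 + 1 / κ)))) ≤
      negPowMean s t κ a b := by
  rcases eq_or_ne a 0 with rfl | ha0
  · simp
  have hb1 : b ≠ ∞ := (hb'.trans_lt ENNReal.one_lt_top).ne
  have ha1 : a ≠ ∞ := (ha.trans_lt (hb.trans_le le_top)).ne
  have haR : a.toReal ≤ 1 / 2 := by simpa using ENNReal.toReal_mono (by simp) ha
  have hbR : 1 / 2 < b.toReal := by simpa using ENNReal.toReal_strict_mono hb1 hb
  have hbR' : b.toReal ≤ 1 := by simpa using ENNReal.toReal_mono (by simp) hb'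
  have haR0 : 0 < a.toReal := ENNReal.toReal_pos ha0 ha1
  have key := Real.le_negPowMean_of_le_half (NNReal.coe_pos.2 (pos_iff_ne_zero.2 ht))
    (NNReal.coe_pos.2 (pos_iff_ne_zero.2 hs)) (by exact_mod_cast hst) haR0 haR hbR hbR' hκ
  have hc0 : 0 ≤ (t : ℝ) * (Real.log (2 * b.toReal) / (1 + 1 / κ)) := by
    have := Real.log_nonneg (show 1 ≤ 2 * b.toReal by linarith)
    positivity
  have hfin := (negPowMean_ne (β := κ) (t := t) hs ha0 ha1
    (pos_of_gt hb).ne' hb1).2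
  rw [← ENNReal.ofReal_toReal hfin, ← ENNReal.ofReal_toReal ha1, ← ENNReal.ofReal_one,
    ← ENNReal.ofReal_add zero_le_one hc0, ← ENNReal.ofReal_mul haR0.le,
    ENNReal.ofReal_toReal ha1]
  refine ENNReal.ofReal_le_ofReal (key.trans_eq ?_)
  have hb0 : b ≠ 0 := (pos_of_gt hb).ne'
  rw [negPowMean, ← ENNReal.toReal_rpow, ENNReal.toReal_add
    (ENNReal.mul_ne_top ENNReal.coe_ne_top (ENNReal.rpow_ne_top_of_ne_zero ha0 ha1))
    (ENNReal.mul_ne_top ENNReal.coe_ne_top (ENNReal.rpow_ne_top_of_ne_zero hb0 hb1)),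
    ENNReal.toReal_mul, ENNReal.toReal_mul, ENNReal.toReal_rpow, ENNReal.toReal_rpow]
  simp

/-- If the `μ`-measure of sets of measure at most `1/2` grows at least linearly with slope `c` under
taking convex combinations with the ball of radius `r`, then `c ∫ f ≤ ∫ |∇f| (r + |x|)` for
compactly supported nonnegative Lipschitz functions `f` whose positivity set has measure
at most `1/2`. Here `G` is any function bounding the upper slope of `f`. -/
lemma mul_lintegral_le_of_lipschitz {E : Type*} [NormedAddCommGroup E] [NormedSpace ℝ E]
    [MeasurableSpace E] [BorelSpace E] {μ : Measure E} [IsProbabilityMeasure μ] {r c : ℝ}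
    (hr : 0 < r)
    (hconc : ∀ s t : ℝ≥0, s ≠ 0 → t ≠ 0 → s + t = 1 → ∀ A C : Set E, MeasurableSet A →
      MeasurableSet C → μ A ≤ 1 / 2 →
      (∀ x ∈ A, ∀ y, ‖y‖ ≤ r → (s : ℝ) • x + (t : ℝ) • y ∈ C) →
      μ A * (1 + ENNReal.ofReal (t * c)) ≤ μ C)
    {f : E → ℝ} {K : ℝ≥0} (hfK : LipschitzWith K f) {N : ℝ} (hfN : ∀ x, f x ≤ N) {R : ℝ}
    (hfR : ∀ x, R < ‖x‖ → f x = 0) (hhalf : μ {x | 0 < f x} ≤ 1 / 2)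
    {G : E → ℝ} (hG : ∀ z, ∀ η > 0, ∀ᶠ x in 𝓝 z, f x - f z ≤ (G z + η) * ‖x - z‖)
    (hG0 : ∀ z, 0 ≤ G z) :
    ENNReal.ofReal c * ∫⁻ x, ENNReal.ofReal (f x) ∂μ ≤
      ∫⁻ x, ENNReal.ofReal (G x * (r + ‖x‖)) ∂μ := by
  set F : E → ℝ≥0∞ := fun x => ENNReal.ofReal (f x) with hF
  have hFm : Measurable F := hfK.continuous.measurable.ennreal_ofReal
  set S : ℝ → E → ℝ≥0∞ := fun t z =>
    ⨆ y : E, ⨆ _ : ‖y‖ ≤ r, F ((1 - t)⁻¹ • (z - t • y)) with hS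
  have hSm : ∀ t, Measurable (S t) := fun t =>
    (lowerSemicontinuous_biSup fun y _ => Continuous.lowerSemicontinuous
      (ENNReal.continuous_ofReal.comp (hfK.continuous.comp (by fun_prop)))).measurable
  set Q : ℝ → E → ℝ≥0∞ := fun t z => ENNReal.ofReal t⁻¹ * (S t z - F z) with hQ
  have hQm : ∀ t, Measurable (Q t) := fun t => ((hSm t).sub hFm).const_mul _
  have hFfin : ∫⁻ x, F x ∂μ ≠ ∞ := by
    refine ne_top_of_le_ne_top (ENNReal.ofReal_ne_top (r := N)) ?_
    calc ∫⁻ x, F x ∂μ ≤ ∫⁻ _, ENNReal.ofReal N ∂μ :=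
          lintegral_mono fun x => ENNReal.ofReal_le_ofReal (hfN x)
      _ = _ := by simp
  -- growth of the integral of the sup-convolution
  have hgrow : ∀ t : ℝ, 0 < t → t < 1 →
      (∫⁻ x, F x ∂μ) * (1 + ENNReal.ofReal (t * c)) ≤ ∫⁻ x, S t x ∂μ := by
    intro t ht0 ht1
    refine le_trans ?_ (lintegral_meas_ofReal_lt_le μ (hSm t))
    rw [lintegral_eq_lintegral_meas_ofReal_lt μ hFm (.of_forall fun x => ENNReal.ofReal_ne_top),
      ← lintegral_mul_const' _ _ (by simp)]
    refine setLIntegral_mono' measurableSet_Ioi fun u hu => ?_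
    lift t to ℝ≥0 using ht0.le
    have ht1' : t < 1 := by exact_mod_cast ht1
    have hcoe : ((1 - t : ℝ≥0) : ℝ) = 1 - t := NNReal.coe_sub ht1'.le
    refine hconc (1 - t) t (tsub_pos_of_lt ht1').ne' (by exact_mod_cast ht0.ne')
      (tsub_add_cancel_of_le ht1'.le) _ _ (measurableSet_lt measurable_const hFm)
      (measurableSet_lt measurable_const (hSm t)) ?_ ?_
    · refine (measure_mono fun x hx => ?_).trans hhalf
      exact ENNReal.ofReal_pos.1 (pos_of_gt hx)
    · intro x hx y hy
      have hx' : ENNReal.ofReal u < F x := hx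
      refine lt_of_lt_of_le hx' ?_
      have h1 : (1 - (t : ℝ)) ≠ 0 := by linarith
      have : x = (1 - (t : ℝ))⁻¹ • (((1 - t : ℝ≥0) : ℝ) • x + (t : ℝ) • y - (t : ℝ) • y) := by
        rw [hcoe, add_sub_cancel_right, smul_smul, inv_mul_cancel₀ h1, one_smul]
      calc F x = F ((1 - (t : ℝ))⁻¹ •
            (((1 - t : ℝ≥0) : ℝ) • x + (t : ℝ) • y - (t : ℝ) • y)) := by rw [← this]
        _ ≤ _ := le_iSup₂_of_le y hy le_rfl
  have hmean : ∀ t : ℝ, 0 < t → t < 1 →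
      ENNReal.ofReal c * ∫⁻ x, F x ∂μ ≤ ∫⁻ x, Q t x ∂μ := by
    intro t ht0 ht1
    have h1 : (∫⁻ x, F x ∂μ) + ENNReal.ofReal (t * c) * ∫⁻ x, F x ∂μ ≤
        (∫⁻ x, F x ∂μ) + ∫⁻ x, S t x - F x ∂μ := by
      calc _ = (∫⁻ x, F x ∂μ) * (1 + ENNReal.ofReal (t * c)) := by ring
        _ ≤ _ := hgrow t ht0 ht1
        _ ≤ ∫⁻ x, (F x + (S t x - F x)) ∂μ := lintegral_mono fun x => le_add_tsub
        _ = _ := lintegral_add_left hFm _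
    have h2 := (ENNReal.add_le_add_iff_left hFfin).1 h1
    have h3 : ∫⁻ x, Q t x ∂μ = ENNReal.ofReal t⁻¹ * ∫⁻ x, S t x - F x ∂μ :=
      lintegral_const_mul _ ((hSm t).sub hFm)
    rw [h3]
    calc ENNReal.ofReal c * ∫⁻ x, F x ∂μ
        = ENNReal.ofReal t⁻¹ * (ENNReal.ofReal (t * c) * ∫⁻ x, F x ∂μ) := by
          rw [← mul_assoc, ← ENNReal.ofReal_mul (inv_nonneg.2 ht0.le),
            inv_mul_cancel_left₀ ht0.ne']
      _ ≤ _ := by gcongr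
  -- displacement of the points entering the sup-convolution
  have hdisp : ∀ (t : ℝ) (z y : E), 0 < t → t < 1 → ‖y‖ ≤ r →
      ‖(1 - t)⁻¹ • (z - t • y) - z‖ ≤ t * ((1 - t)⁻¹ * (r + ‖z‖)) := by
    intro t z y ht0 ht1 hy
    have h1 : 1 - t ≠ 0 := by linarith
    have h2 : (1 - t)⁻¹ • (z - t • y) - z = (t * (1 - t)⁻¹) • (z - y) := by
      have : z = (1 - t)⁻¹ • ((1 - t) • z) := by rw [smul_smul, inv_mul_cancel₀ h1, one_smul]
      nth_rewrite 2 [this]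
      rw [← smul_sub, mul_comm, mul_smul]
      congr 1
      module
    have h3 : 0 < 1 - t := by linarith
    rw [h2, norm_smul, Real.norm_of_nonneg (by positivity), mul_assoc]
    gcongr
    linarith [norm_sub_le z y]
  have hQle : ∀ (t M : ℝ) (z : E), 0 < t →
      (∀ y, ‖y‖ ≤ r → f ((1 - t)⁻¹ • (z - t • y)) ≤ f z + t * M) → 0 ≤ M →
      Q t z ≤ ENNReal.ofReal M := by
    intro t M z ht0 h hM
    have h1 : S t z - F z ≤ ENNReal.ofReal (t * M) := by
      rw [tsub_le_iff_left]
      refine iSup₂_le fun y hy => ?_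
      exact (ENNReal.ofReal_le_ofReal (h y hy)).trans ENNReal.ofReal_add_le
    calc Q t z ≤ ENNReal.ofReal t⁻¹ * ENNReal.ofReal (t * M) := by
          simp only [hQ]; gcongr
      _ = _ := by
        rw [← ENNReal.ofReal_mul (inv_nonneg.2 ht0.le), inv_mul_cancel_left₀ ht0.ne']
  set B : ℝ := K * (2 * (r + (|R| + r))) with hB
  have hbound : ∀ (t : ℝ), 0 < t → t ≤ 1 / 2 → ∀ z, Q t z ≤ ENNReal.ofReal B := by
    intro t ht0 ht1 z
    by_cases hz : ‖z‖ ≤ |R| + r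
    · refine hQle t B z ht0 (fun y hy => ?_) (by positivity)
      have h1 := hfK.dist_le_mul ((1 - t)⁻¹ • (z - t • y)) z
      rw [Real.dist_eq, dist_eq_norm] at h1
      have h2 := hdisp t z y ht0 (by linarith) hy
      have h3 : (1 - t)⁻¹ ≤ 2 := by
        rw [inv_le_comm₀ (by linarith) (by norm_num)]; linarith
      have h4 : (K : ℝ) * ‖(1 - t)⁻¹ • (z - t • y) - z‖ ≤ t * B := by
        calc (K : ℝ) * ‖(1 - t)⁻¹ • (z - t • y) - z‖ ≤ K * (t * (2 * (r + (|R| + r)))) := by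
              gcongr
              exact h2.trans (by gcongr)
          _ = t * B := by rw [hB]; ring
      linarith [le_abs_self (f ((1 - t)⁻¹ • (z - t • y)) - f z)]
    · have h0 : S t z = 0 := by
        simp only [hS, ENNReal.iSup_eq_zero]
        intro y hy
        have : f ((1 - t)⁻¹ • (z - t • y)) = 0 := by
          refine hfR _ ?_
          have h1 : 0 < 1 - t := by linarith
          rw [norm_smul, norm_inv, Real.norm_of_nonneg h1.le, ← div_eq_inv_mul, lt_div_iff₀ h1]
          have h2 : ‖t • y‖ ≤ r := by
            rw [norm_smul, Real.norm_of_nonneg ht0.le]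
            nlinarith [norm_nonneg y]
          have h3 := norm_sub_norm_le z (t • y)
          have h4 : R * (1 - t) ≤ |R| := by nlinarith [le_abs_self R, abs_nonneg R]
          linarith
        simp [hF, this]
      simp [hQ, h0]
  -- passage to the limit
  set τ : ℕ → ℝ := fun j => 1 / ((j : ℝ) + 2) with hτ
  have hτ0 : ∀ j, 0 < τ j := fun j => by positivity
  have hτ1 : ∀ j, τ j ≤ 1 / 2 := fun j =>
    one_div_le_one_div_of_le (by norm_num) (by linarith [j.cast_nonneg (α := ℝ)])
  have hτlim : Tendsto τ atTop (𝓝 0) :=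
    tendsto_const_nhds.div_atTop (tendsto_natCast_atTop_atTop.atTop_add tendsto_const_nhds)
  have hlim : ∀ z, limsup (fun j => Q (τ j) z) atTop ≤ ENNReal.ofReal (G z * (r + ‖z‖)) := by
    intro z
    have hη : ∀ η : ℝ, 0 < η → limsup (fun j => Q (τ j) z) atTop ≤
        ENNReal.ofReal ((G z + η) * ((1 + η) * (r + ‖z‖))) := by
      intro η hη
      refine limsup_le_of_le (by isBoundedDefault) ?_
      obtain ⟨δ, hδ, hGδ⟩ := Metric.eventually_nhds_iff.1 (hG z η hη)
      have hinv : Tendsto (fun j => (1 - τ j)⁻¹) atTop (𝓝 1) := by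
        simpa using (tendsto_const_nhds.sub hτlim).inv₀ (by norm_num : (1 : ℝ) - 0 ≠ 0)
      have hdist : Tendsto (fun j => τ j * ((1 - τ j)⁻¹ * (r + ‖z‖))) atTop (𝓝 0) := by
        simpa using hτlim.mul (hinv.mul_const (r + ‖z‖))
      filter_upwards [hinv.eventually (gt_mem_nhds (show 1 < 1 + η by linarith)),
        hdist.eventually (gt_mem_nhds hδ)] with j hj1 hj2
      have hGη : 0 ≤ G z + η := add_nonneg (hG0 z) hη.le
      refine hQle _ _ _ (hτ0 j) (fun y hy => ?_) (by positivity)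
      have h1 := hdisp (τ j) z y (hτ0 j) (by linarith [hτ1 j]) hy
      have h2 := hGδ (y := (1 - τ j)⁻¹ • (z - τ j • y)) (by rw [dist_eq_norm]; linarith)
      have h3 : (G z + η) * ‖(1 - τ j)⁻¹ • (z - τ j • y) - z‖ ≤
          τ j * ((G z + η) * ((1 + η) * (r + ‖z‖))) := by
        calc _ ≤ (G z + η) * (τ j * ((1 + η) * (r + ‖z‖))) := by
              gcongr
              refine h1.trans ?_
              have := (hτ0 j).le
              gcongr
          _ = _ := by ring
      linarith
    have hcont : Tendsto (fun η : ℝ => ENNReal.ofReal ((G z + η) * ((1 + η) * (r + ‖z‖))))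
        (𝓝[>] 0) (𝓝 (ENNReal.ofReal (G z * (r + ‖z‖)))) := by
      have : Continuous fun η : ℝ => ENNReal.ofReal ((G z + η) * ((1 + η) * (r + ‖z‖))) :=
        ENNReal.continuous_ofReal.comp (by fun_prop)
      simpa using (this.tendsto 0).mono_left nhdsWithin_le_nhds
    exact ge_of_tendsto hcont (eventually_mem_nhdsWithin.mono fun η h => hη η h)
  calc ENNReal.ofReal c * ∫⁻ x, F x ∂μ
      ≤ limsup (fun j => ∫⁻ x, Q (τ j) x ∂μ) atTop :=
        (limsup_const _).symm.le.trans (limsup_le_limsup (.of_forall fun j =>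
          hmean _ (hτ0 j) (by linarith [hτ1 j])))
    _ ≤ ∫⁻ x, limsup (fun j => Q (τ j) x) atTop ∂μ :=
        limsup_lintegral_le (fun _ => ENNReal.ofReal B) (fun j => hQm _)
          (fun j => .of_forall (hbound _ (hτ0 j) (hτ1 j))) (by simp)
    _ ≤ _ := lintegral_mono hlim

lemma eventually_abs_sub_le_of_contDiff {E : Type*} [NormedAddCommGroup E] [NormedSpace ℝ E]
    {g : E → ℝ} (hg : Differentiable ℝ g) (z : E) {η : ℝ} (hη : 0 < η) :
    ∀ᶠ x in 𝓝 z, |g x - g z| ≤ (‖fderiv ℝ g z‖ + η) * ‖x - z‖ := by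
  filter_upwards [((hg z).hasFDerivAt.isLittleO).def hη] with x hx
  have h1 := (fderiv ℝ g z).le_opNorm (x - z)
  have h2 := norm_le_norm_add_norm_sub' (g x - g z) (fderiv ℝ g z (x - z))
  rw [Real.norm_eq_abs] at h2
  linarith

/-- The truncation `min ((a - ε)⁺) N`. -/
noncomputable def truncPos (ε N a : ℝ) : ℝ := min (max (a - ε) 0) N

/-- A Lipschitz cutoff, equal to `1` on the ball of radius `R` and to `0` off the ball of
radius `2 R`. -/
noncomputable def normCutoff {E : Type*} [NormedAddCommGroup E] (R : ℝ) (x : E) : ℝ :=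
  max (min (2 - ‖x‖ / R) 1) 0

section cutoff

variable {E : Type*} [NormedAddCommGroup E] {R ε N : ℝ}

lemma truncPos_nonneg (hN : 0 ≤ N) (a : ℝ) : 0 ≤ truncPos ε N a :=
  le_min (le_max_right _ _) hN

lemma truncPos_eq_zero (hN : 0 ≤ N) {a : ℝ} (ha : a ≤ ε) : truncPos ε N a = 0 := by
  rw [truncPos, max_eq_right (by linarith), min_eq_left hN]

lemma lipschitzWith_truncPos : LipschitzWith 1 (truncPos ε N) := by
  have h : LipschitzWith 1 fun a : ℝ => a - ε :=
    LipschitzWith.of_dist_le_mul fun x y => by simp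
  exact (h.max_const 0).min_const N

lemma abs_truncPos_sub_le (a b : ℝ) : |truncPos ε N a - truncPos ε N b| ≤ |a - b| := by
  simpa [Real.dist_eq] using (lipschitzWith_truncPos (ε := ε) (N := N)).dist_le_mul a b

lemma normCutoff_nonneg (x : E) : 0 ≤ normCutoff R x := le_max_right _ _

lemma normCutoff_le_one (x : E) : normCutoff R x ≤ 1 := max_le (min_le_right _ _) zero_le_one

lemma normCutoff_eq_one (hR : 0 < R) {x : E} (hx : ‖x‖ ≤ R) : normCutoff R x = 1 := by
  have : ‖x‖ / R ≤ 1 := (div_le_one hR).2 hx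
  rw [normCutoff, min_eq_right (by linarith), max_eq_left zero_le_one]

lemma normCutoff_eq_zero (hR : 0 < R) {x : E} (hx : 2 * R ≤ ‖x‖) : normCutoff R x = 0 := by
  have : 2 ≤ ‖x‖ / R := (le_div_iff₀ hR).2 hx
  rw [normCutoff, max_eq_right ((min_le_left _ _).trans (by linarith))]

lemma abs_normCutoff_sub_le (hR : 0 < R) (x z : E) :
    |normCutoff R x - normCutoff R z| ≤ R⁻¹ * ‖x - z‖ := by
  have h : LipschitzWith (Real.toNNReal R⁻¹) fun a : E => 2 - ‖a‖ / R := by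
    refine LipschitzWith.of_dist_le_mul fun x y => ?_
    rw [Real.coe_toNNReal _ (by positivity), Real.dist_eq, dist_eq_norm,
      show 2 - ‖x‖ / R - (2 - ‖y‖ / R) = R⁻¹ * (‖y‖ - ‖x‖) by ring, abs_mul,
      abs_of_pos (inv_pos.2 hR), norm_sub_rev]
    gcongr
    exact abs_norm_sub_norm_le y x
  have h2 := ((h.min_const 1).max_const 0).dist_le_mul x z
  rwa [Real.coe_toNNReal _ (by positivity), Real.dist_eq, dist_eq_norm] at h2

lemma cutoff_mul_sub_le (hN : 0 ≤ N) (x z : E) (a b : ℝ) :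
    |normCutoff R x * truncPos ε N a - normCutoff R z * truncPos ε N b| ≤
      |truncPos ε N a - truncPos ε N b| + N * |normCutoff R x - normCutoff R z| := by
  have h1 : normCutoff R x * truncPos ε N a - normCutoff R z * truncPos ε N b =
      normCutoff R x * (truncPos ε N a - truncPos ε N b) +
        truncPos ε N b * (normCutoff R x - normCutoff R z) := by ring
  have h2 : truncPos ε N b ≤ N := min_le_right _ _
  rw [h1]
  refine (abs_add_le _ _).trans ?_
  rw [abs_mul, abs_mul, abs_of_nonneg (normCutoff_nonneg x), abs_of_nonneg (truncPos_nonneg hN b)]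
  gcongr
  exact mul_le_of_le_one_left (abs_nonneg _) (normCutoff_le_one x)

lemma exists_lipschitzWith_cutoff [InnerProductSpace ℝ E] [FiniteDimensional ℝ E]
    {g : E → ℝ} (hg : ContDiff ℝ 1 g) (hR : 0 < R) (hN : 0 ≤ N) :
    ∃ K, LipschitzWith K fun x => normCutoff R x * truncPos ε N (g x) := by
  let b : ContDiffBump (0 : E) := ⟨2 * R, 2 * R + 1, by positivity, by linarith⟩
  have hbg : ContDiff ℝ 1 fun x => b x * g x := b.contDiff.mul hg
  obtain ⟨C, hC⟩ := hbg.lipschitzWith_of_hasCompactSupport b.hasCompactSupport.mul_right one_ne_zero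
  have heq : ∀ x, normCutoff R x * truncPos ε N (g x) =
      normCutoff R x * truncPos ε N (b x * g x) := fun x => by
    rcases le_total ‖x‖ (2 * R) with hx | hx
    · rw [b.one_of_mem_closedBall (by simpa using hx), one_mul]
    · rw [normCutoff_eq_zero hR hx, zero_mul, zero_mul]
  refine ⟨C + Real.toNNReal (N * R⁻¹), LipschitzWith.of_dist_le_mul fun x z => ?_⟩
  have h1 := hC.dist_le_mul x z
  rw [Real.dist_eq, dist_eq_norm] at h1
  rw [heq x, heq z, Real.dist_eq, dist_eq_norm, NNReal.coe_add,
    Real.coe_toNNReal _ (by positivity), add_mul, mul_assoc N]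
  refine (cutoff_mul_sub_le hN x z _ _).trans ?_
  gcongr
  · exact (abs_truncPos_sub_le _ _).trans h1
  · exact abs_normCutoff_sub_le hR x z

end cutoff

lemma mul_lintegral_cutoff_le {E : Type*} [NormedAddCommGroup E] [InnerProductSpace ℝ E]
    [FiniteDimensional ℝ E] [MeasurableSpace E] [BorelSpace E] {μ : Measure E}
    [IsProbabilityMeasure μ] {r c : ℝ} (hr : 0 < r)
    (hconc : ∀ s t : ℝ≥0, s ≠ 0 → t ≠ 0 → s + t = 1 → ∀ A C : Set E, MeasurableSet A →
      MeasurableSet C → μ A ≤ 1 / 2 →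
      (∀ x ∈ A, ∀ y, ‖y‖ ≤ r → (s : ℝ) • x + (t : ℝ) • y ∈ C) →
      μ A * (1 + ENNReal.ofReal (t * c)) ≤ μ C)
    {g : E → ℝ} (hg : ContDiff ℝ 1 g) (hhalf : μ {x | 0 < g x} ≤ 1 / 2)
    {R ε N : ℝ} (hR : r ≤ R) (hε : 0 < ε) (hN : 0 ≤ N) :
    ENNReal.ofReal c * ∫⁻ x, ENNReal.ofReal (normCutoff R x * truncPos ε N (g x)) ∂μ ≤
      (∫⁻ x in {x | 0 < g x}, ENNReal.ofReal (‖fderiv ℝ g x‖ * (r + ‖x‖)) ∂μ) +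
        ENNReal.ofReal (3 * N) * μ {x | R ≤ ‖x‖} := by
  classical
  have hR0 : 0 < R := hr.trans_le hR
  obtain ⟨K, hK⟩ := exists_lipschitzWith_cutoff (ε := ε) hg hR0 hN
  set G₁ : E → ℝ := {x | 0 < g x}.indicator fun x => ‖fderiv ℝ g x‖ with hG₁
  set G₂ : E → ℝ := {x | R ≤ ‖x‖ ∧ ‖x‖ ≤ 2 * R}.indicator fun _ => N * R⁻¹ with hG₂
  have hG₁0 : ∀ x, 0 ≤ G₁ x := fun x => indicator_nonneg (fun _ _ => norm_nonneg _) x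
  have hG₂0 : ∀ x, 0 ≤ G₂ x := fun x => indicator_nonneg (fun _ _ => by positivity) x
  have hslope₁ : ∀ z, ∀ η > 0, ∀ᶠ x in 𝓝 z,
      |truncPos ε N (g x) - truncPos ε N (g z)| ≤ (G₁ z + η) * ‖x - z‖ := by
    intro z η hη
    by_cases hz : 0 < g z
    · filter_upwards [eventually_abs_sub_le_of_contDiff (hg.differentiable one_ne_zero) z hη]
        with x hx
      rw [hG₁, indicator_of_mem (by exact hz)]
      exact (abs_truncPos_sub_le _ _).trans hx
    · have h1 : ∀ᶠ x in 𝓝 z, g x < ε :=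
        hg.continuous.continuousAt.eventually_lt continuousAt_const (by linarith)
      filter_upwards [h1] with x hx
      rw [truncPos_eq_zero hN hx.le, truncPos_eq_zero hN (by linarith), sub_zero, abs_zero]
      have := hG₁0 z
      positivity
  have hslope₂ : ∀ z : E, ∀ᶠ x in 𝓝 z,
      N * |normCutoff R x - normCutoff R z| ≤ G₂ z * ‖x - z‖ := by
    intro z
    by_cases hz1 : ‖z‖ < R
    · filter_upwards [continuous_norm.continuousAt.eventually_lt continuousAt_const hz1] with x hx
      rw [normCutoff_eq_one hR0 hx.le, normCutoff_eq_one hR0 hz1.le, sub_self, abs_zero, mul_zero]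
      have := hG₂0 z
      positivity
    by_cases hz2 : ‖z‖ ≤ 2 * R
    · refine .of_forall fun x => ?_
      rw [hG₂, indicator_of_mem (by exact ⟨not_lt.1 hz1, hz2⟩), mul_assoc]
      gcongr
      exact abs_normCutoff_sub_le hR0 x z
    · rw [not_le] at hz2
      filter_upwards [continuousAt_const.eventually_lt continuous_norm.continuousAt hz2] with x hx
      rw [normCutoff_eq_zero hR0 hx.le, normCutoff_eq_zero hR0 hz2.le, sub_self, abs_zero, mul_zero]
      have := hG₂0 z
      positivity
  have key := mul_lintegral_le_of_lipschitz hr hconc hK (N := N) (R := 2 * R)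
    (fun x => (mul_le_of_le_one_left (truncPos_nonneg hN _) (normCutoff_le_one x)).trans
      (min_le_right _ _))
    (fun x hx => by rw [normCutoff_eq_zero hR0 hx.le, zero_mul])
    ((measure_mono fun x hx => ?_).trans hhalf) (G := fun x => G₁ x + G₂ x) ?_
    fun x => add_nonneg (hG₁0 x) (hG₂0 x)
  · refine key.trans ?_
    have hm1 : MeasurableSet {x | 0 < g x} := measurableSet_lt measurable_const
      hg.continuous.measurable
    have hm2 : MeasurableSet {x : E | R ≤ ‖x‖} := measurableSet_le measurable_const measurable_norm
    rw [← lintegral_indicator hm1, ← lintegral_indicator_const hm2,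
      ← lintegral_add_right _ (measurable_const.indicator hm2)]
    refine lintegral_mono fun x => ?_
    have h0 : 0 ≤ r + ‖x‖ := by positivity
    simp only [add_mul]
    rw [ENNReal.ofReal_add (mul_nonneg (hG₁0 x) h0) (mul_nonneg (hG₂0 x) h0)]
    refine add_le_add (le_of_eq ?_) ?_
    · by_cases hx : x ∈ {x | 0 < g x}
      · rw [hG₁, indicator_of_mem hx, indicator_of_mem hx]
      · rw [hG₁, indicator_of_notMem hx, indicator_of_notMem hx, zero_mul, ENNReal.ofReal_zero]
    · by_cases hx : R ≤ ‖x‖ ∧ ‖x‖ ≤ 2 * R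
      · rw [hG₂, indicator_of_mem (by exact hx), indicator_of_mem (by exact hx.1)]
        refine ENNReal.ofReal_le_ofReal ?_
        calc N * R⁻¹ * (r + ‖x‖) ≤ N * R⁻¹ * (R + 2 * R) := by
              gcongr
              exact hx.2
          _ = 3 * N := by field_simp; ring
      · rw [hG₂, indicator_of_notMem (by exact hx), zero_mul, ENNReal.ofReal_zero]
        exact zero_le
  · by_contra h
    have h1 : truncPos ε N (g x) = 0 := truncPos_eq_zero hN ((not_lt.1 h).trans hε.le)
    simp [h1] at hx
  · intro z η hη
    filter_upwards [hslope₁ z η hη, hslope₂ z] with x h1 h2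
    have h3 := (le_abs_self _).trans (cutoff_mul_sub_le (R := R) (ε := ε) hN x z (g x) (g z))
    linarith

lemma exists_measure_norm_ge_lt {E : Type*} [NormedAddCommGroup E] [MeasurableSpace E]
    [BorelSpace E] (μ : Measure E) [IsFiniteMeasure μ] (r : ℝ) {δ : ℝ≥0∞} (hδ : 0 < δ) :
    ∃ R, r ≤ R ∧ μ {x | R ≤ ‖x‖} < δ := by
  have hlim : Tendsto (fun m : ℕ => μ {x | (m : ℝ) ≤ ‖x‖}) atTop (𝓝 0) := by
    have h := tendsto_measure_iInter_atTop (μ := μ) (s := fun m : ℕ => {x : E | (m : ℝ) ≤ ‖x‖})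
      (fun m => (measurableSet_le measurable_const measurable_norm).nullMeasurableSet)
      (fun m k hmk x (hx : (k : ℝ) ≤ ‖x‖) =>
        show (m : ℝ) ≤ ‖x‖ from le_trans (Nat.cast_le.2 hmk) hx) ⟨0, measure_ne_top _ _⟩
    have h0 : ⋂ m : ℕ, {x : E | (m : ℝ) ≤ ‖x‖} = ∅ := by
      refine eq_empty_of_forall_notMem fun x hx => ?_
      obtain ⟨m, hm⟩ := exists_nat_gt ‖x‖
      exact absurd (mem_iInter.1 hx m) (not_le.2 hm)
    rwa [h0, measure_empty] at h
  obtain ⟨m, hm1, hm2⟩ := ((hlim.eventually (gt_mem_nhds hδ)).and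
    (tendsto_natCast_atTop_atTop.eventually_ge_atTop r)).exists
  exact ⟨m, hm2, hm1⟩

/-- The weighted Cheeger inequality for the positive part of a function. -/
lemma mul_lintegral_pos_le {E : Type*} [NormedAddCommGroup E] [InnerProductSpace ℝ E]
    [FiniteDimensional ℝ E] [MeasurableSpace E] [BorelSpace E] {μ : Measure E}
    [IsProbabilityMeasure μ] {r c : ℝ} (hr : 0 < r)
    (hconc : ∀ s t : ℝ≥0, s ≠ 0 → t ≠ 0 → s + t = 1 → ∀ A C : Set E, MeasurableSet A →
      MeasurableSet C → μ A ≤ 1 / 2 →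
      (∀ x ∈ A, ∀ y, ‖y‖ ≤ r → (s : ℝ) • x + (t : ℝ) • y ∈ C) →
      μ A * (1 + ENNReal.ofReal (t * c)) ≤ μ C)
    {g : E → ℝ} (hg : ContDiff ℝ 1 g) (hhalf : μ {x | 0 < g x} ≤ 1 / 2) :
    ENNReal.ofReal c * ∫⁻ x, ENNReal.ofReal (g x) ∂μ ≤
      ∫⁻ x in {x | 0 < g x}, ENNReal.ofReal (‖fderiv ℝ g x‖ * (r + ‖x‖)) ∂μ := by
  set I := ∫⁻ x in {x | 0 < g x}, ENNReal.ofReal (‖fderiv ℝ g x‖ * (r + ‖x‖)) ∂μ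
  have hδ : ∀ j : ℕ, 0 < ENNReal.ofReal (1 / ((j : ℝ) + 1) ^ 2) := fun j =>
    ENNReal.ofReal_pos.2 (by positivity)
  choose R hR hμR using fun j : ℕ => exists_measure_norm_ge_lt μ (max r j) (hδ j)
  set f : ℕ → E → ℝ≥0∞ := fun j x => ENNReal.ofReal
    (normCutoff (R j) x * truncPos (1 / ((j : ℝ) + 1)) j (g x)) with hf
  have hfm : ∀ j, Measurable (f j) := fun j => by
    obtain ⟨K, hK⟩ := exists_lipschitzWith_cutoff (ε := 1 / ((j : ℝ) + 1)) hg
      (hr.trans_le ((le_max_left _ _).trans (hR j))) (Nat.cast_nonneg j)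
    exact hK.continuous.measurable.ennreal_ofReal
  have hone : Tendsto (fun j : ℕ => 1 / ((j : ℝ) + 1)) atTop (𝓝 0) :=
    tendsto_one_div_add_atTop_nhds_zero_nat
  have hlim : ∀ x, Tendsto (fun j => f j x) atTop (𝓝 (ENNReal.ofReal (g x))) := by
    intro x
    have h1 : Tendsto (fun j : ℕ => ENNReal.ofReal (max (g x - 1 / ((j : ℝ) + 1)) 0)) atTop
        (𝓝 (ENNReal.ofReal (max (g x - 0) 0))) :=
      ENNReal.tendsto_ofReal ((tendsto_const_nhds.sub hone).max tendsto_const_nhds)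
    have h2 : ENNReal.ofReal (max (g x - 0) 0) = ENNReal.ofReal (g x) := by
      simp [ENNReal.ofReal_max]
    rw [h2] at h1
    refine h1.congr' ?_
    filter_upwards [tendsto_natCast_atTop_atTop.eventually_ge_atTop ‖x‖,
      tendsto_natCast_atTop_atTop.eventually_ge_atTop (g x)] with j hj1 hj2
    have hj : (0 : ℝ) ≤ j := j.cast_nonneg
    have hpos : 0 ≤ 1 / ((j : ℝ) + 1) := by positivity
    simp only [hf]
    rw [normCutoff_eq_one (hr.trans_le ((le_max_left _ _).trans (hR j)))
      (hj1.trans ((le_max_right _ _).trans (hR j))), one_mul, truncPos,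
      min_eq_left (max_le (by linarith) hj)]
  have hbound : ∀ j, ENNReal.ofReal c * ∫⁻ x, f j x ∂μ ≤
      I + ENNReal.ofReal (3 * (1 / ((j : ℝ) + 1))) := by
    intro j
    refine (mul_lintegral_cutoff_le hr hconc hg hhalf ((le_max_left _ _).trans (hR j))
      (by positivity) (Nat.cast_nonneg j)).trans ?_
    gcongr
    calc ENNReal.ofReal (3 * j) * μ {x | R j ≤ ‖x‖}
        ≤ ENNReal.ofReal (3 * j) * ENNReal.ofReal (1 / ((j : ℝ) + 1) ^ 2) := by
          gcongr
          exact (hμR j).le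
      _ = ENNReal.ofReal (3 * j * (1 / ((j : ℝ) + 1) ^ 2)) :=
          (ENNReal.ofReal_mul (by positivity)).symm
      _ ≤ _ := by
        refine ENNReal.ofReal_le_ofReal ?_
        rw [mul_assoc]
        gcongr
        rw [mul_one_div, div_le_div_iff₀ (by positivity) (by positivity)]
        nlinarith [j.cast_nonneg (α := ℝ)]
  have hrhs : Tendsto (fun j : ℕ => I + ENNReal.ofReal (3 * (1 / ((j : ℝ) + 1)))) atTop (𝓝 I) := by
    simpa using tendsto_const_nhds.add (ENNReal.tendsto_ofReal (hone.const_mul 3))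
  calc ENNReal.ofReal c * ∫⁻ x, ENNReal.ofReal (g x) ∂μ
      = ∫⁻ x, liminf (fun j => ENNReal.ofReal c * f j x) atTop ∂μ := by
        rw [← lintegral_const_mul _ hg.continuous.measurable.ennreal_ofReal]
        exact lintegral_congr fun x =>
          (ENNReal.Tendsto.const_mul (hlim x) (.inr ENNReal.ofReal_ne_top)).liminf_eq.symm
    _ ≤ liminf (fun j => ∫⁻ x, ENNReal.ofReal c * f j x ∂μ) atTop :=
        lintegral_liminf_le fun j => (hfm j).const_mul _
    _ ≤ liminf (fun j : ℕ => I + ENNReal.ofReal (3 * (1 / ((j : ℝ) + 1)))) atTop := by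
        refine liminf_le_liminf (.of_forall fun j => ?_)
        rw [lintegral_const_mul _ (hfm j)]
        exact hbound j
    _ = I := hrhs.liminf_eq

/-- **Weighted Cheeger-type inequality (5.4)**: let `μ` be a probability measure on `ℝⁿ`
with density `V^{−β}`, `β > n`, where `V` is positive and convex on a convex set `Ω`
(the effective domain of `V`, which may take the value `+∞` outside), and set
`κ = −1/(β−n)`.  If `r > 0` satisfies `μ(B_r) > 1/2` for the ball `B_r = {|x| ≤ r}`, and
`D = (1 − κ)/log(2μ(B_r))`, then every smooth `g` with `μ`-median zero satisfies
`∫ |g| dμ ≤ D ∫ |∇g| (r + |x|) dμ`. -/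
theorem weighted_cheeger_convex_measures
    {n : ℕ} (hn : 0 < n) (β : ℝ) (hβ : (n : ℝ) < β)
    (Ω : Set (EuclideanSpace ℝ (Fin n))) (hΩc : Convex ℝ Ω) (hΩm : MeasurableSet Ω)
    (V : EuclideanSpace ℝ (Fin n) → ℝ)
    (hVpos : ∀ x ∈ Ω, 0 < V x) (hVconv : ConvexOn ℝ Ω V) (hVmeas : Measurable V)
    (μ : Measure (EuclideanSpace ℝ (Fin n)))
    (hμ : μ = (volume.restrict Ω).withDensity fun x => ENNReal.ofReal (V x ^ (-β)))
    (hμp : IsProbabilityMeasure μ)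
    (r : ℝ) (hr : 0 < r) (hhalf : (1 / 2 : ℝ≥0∞) < μ {x | ‖x‖ ≤ r})
    (g : EuclideanSpace ℝ (Fin n) → ℝ) (hg : ContDiff ℝ (⊤ : ℕ∞) g)
    (hmed1 : (1 / 2 : ℝ≥0∞) ≤ μ {x | 0 ≤ g x})
    (hmed2 : (1 / 2 : ℝ≥0∞) ≤ μ {x | g x ≤ 0}) :
    (∫⁻ x, ENNReal.ofReal |g x| ∂μ) ≤
      ENNReal.ofReal
          ((1 - (-(1 / (β - n)))) / Real.log (2 * (μ {x | ‖x‖ ≤ r}).toReal)) *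
        ∫⁻ x, ENNReal.ofReal (‖gradient g x‖ * (r + ‖x‖)) ∂μ := by
  have hκ : 0 < β - n := sub_pos.2 hβ
  set b := μ {x | ‖x‖ ≤ r} with hb
  have hb1 : b ≤ 1 := prob_le_one
  have hbR : 1 / 2 < b.toReal := by
    simpa using ENNReal.toReal_strict_mono (measure_ne_top _ _) hhalf
  have hlog : 0 < Real.log (2 * b.toReal) := Real.log_pos (by linarith)
  set c := Real.log (2 * b.toReal) / (1 + 1 / (β - n)) with hc
  have hc0 : 0 < c := by positivity
  have hconc : ∀ s t : ℝ≥0, s ≠ 0 → t ≠ 0 → s + t = 1 →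
      ∀ A C : Set (EuclideanSpace ℝ (Fin n)), MeasurableSet A → MeasurableSet C → μ A ≤ 1 / 2 →
      (∀ x ∈ A, ∀ y, ‖y‖ ≤ r → (s : ℝ) • x + (t : ℝ) • y ∈ C) →
      μ A * (1 + ENNReal.ofReal (t * c)) ≤ μ C := fun s t hs ht hst A C hA hC hA' hAC =>
    (le_negPowMean_of_le_half hs ht hst hA' hhalf hb1 hκ).trans
      (negPowMean_measure_le hβ hΩm hVpos hVconv hVmeas hs ht hst hA
        (measurableSet_le measurable_norm measurable_const) hC hAC hμ)
  have hg1 : ContDiff ℝ 1 g := hg.of_le (by exact_mod_cast le_top)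
  have hgm : Measurable g := hg1.continuous.measurable
  have hmpos : MeasurableSet {x | 0 < g x} := measurableSet_lt measurable_const hgm
  have hmneg : MeasurableSet {x | g x < 0} := measurableSet_lt hgm measurable_const
  have hhalf_compl : ∀ S : Set (EuclideanSpace ℝ (Fin n)), MeasurableSet S →
      1 / 2 ≤ μ Sᶜ → μ S ≤ 1 / 2 := fun S hS h => by
    have h1 := prob_compl_eq_one_sub (μ := μ) hS.compl
    rw [compl_compl] at h1
    rw [h1, tsub_le_iff_left]
    calc (1 : ℝ≥0∞) = 1 / 2 + 1 / 2 := (ENNReal.add_halves 1).symm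
      _ ≤ _ := by gcongr
  have hpos := mul_lintegral_pos_le hr hconc hg1 (hhalf_compl _ hmpos (by
    simpa only [compl_ofPred, not_lt] using hmed2))
  have hneg := mul_lintegral_pos_le hr hconc hg1.neg (hhalf_compl _ (by simpa using hmneg) (by
    simpa only [compl_ofPred, not_lt, neg_nonpos] using hmed1))
  set w : EuclideanSpace ℝ (Fin n) → ℝ≥0∞ := fun x =>
    ENNReal.ofReal (‖fderiv ℝ g x‖ * (r + ‖x‖)) with hw
  have hgrad : ∀ x, ENNReal.ofReal (‖gradient g x‖ * (r + ‖x‖)) = w x := fun x => by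
    rw [gradient, LinearIsometryEquiv.norm_map]
  have hnegw : ∀ x, ENNReal.ofReal (‖fderiv ℝ (fun x => -g x) x‖ * (r + ‖x‖)) = w x := fun x => by
    rw [fderiv_fun_neg, norm_neg]
  have hneg' : ENNReal.ofReal c * ∫⁻ x, ENNReal.ofReal (-g x) ∂μ ≤
      ∫⁻ x in {x | g x < 0}, w x ∂μ := by
    simpa only [hnegw, Left.neg_pos_iff] using hneg
  have habs : ∫⁻ x, ENNReal.ofReal |g x| ∂μ =
      (∫⁻ x, ENNReal.ofReal (g x) ∂μ) + ∫⁻ x, ENNReal.ofReal (-g x) ∂μ := by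
    rw [← lintegral_add_left hgm.ennreal_ofReal]
    refine lintegral_congr fun x => ?_
    rcases le_total 0 (g x) with h | h
    · rw [abs_of_nonneg h, ENNReal.ofReal_of_nonpos (neg_nonpos.2 h), add_zero]
    · rw [abs_of_nonpos h, ENNReal.ofReal_of_nonpos h, zero_add]
  have hsum : ENNReal.ofReal c * ∫⁻ x, ENNReal.ofReal |g x| ∂μ ≤ ∫⁻ x, w x ∂μ := by
    rw [habs, mul_add]
    refine (add_le_add hpos hneg').trans ?_
    have hdisj : Disjoint {x | 0 < g x} {x | g x < 0} :=
      disjoint_left.2 fun x (h1 : 0 < g x) (h2 : g x < 0) => h1.asymm h2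
    rw [← lintegral_union hmneg hdisj]
    exact setLIntegral_le_lintegral _ _
  simp only [hgrad]
  have hD : (1 - -(1 / (β - n))) / Real.log (2 * b.toReal) = c⁻¹ := by
    rw [hc, inv_div, sub_neg_eq_add]
  rw [hD]
  calc ∫⁻ x, ENNReal.ofReal |g x| ∂μ
      = ENNReal.ofReal c⁻¹ * (ENNReal.ofReal c * ∫⁻ x, ENNReal.ofReal |g x| ∂μ) := by
        rw [← mul_assoc, ← ENNReal.ofReal_mul (inv_nonneg.2 hc0.le), inv_mul_cancel₀ hc0.ne',
          ENNReal.ofReal_one, one_mul]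
    _ ≤ _ := by gcongr
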